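/- Let G be an M×M real matrix with nonnegative entries whose columns each sum to 1 (column-stochastic), and let A be the M×M diagonal matrix with diagonal entries α_k satisfying 0 ≤ α_k < 1 for every k. Let χ, χ' be reals with 0 ≤ χ ≤ χ' ≤ 1. Then I − χ·G·A and I − χ'·G·A are both invertible, and for all indices h, k: ((I − χ·G·A)⁻¹)_{hk} ≤ ((I − χ'·G·A)⁻¹)_{hk}. In particular, the dampened Input Rank υ_{hk}(χ·GA) never exceeds the full-information Input Rank υ_{hk}(GA). -/

import Mathlib

open Matrix

namespace Matrix

variable {n : Type*} [Fintype n] [DecidableEq n] {B : Matrix n n ℝ}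

/-- A minimum principle: if `B` is nonnegative with column sums less than one, then `1 - B` is
inverse-positive for the action on row vectors. -/
theorem nonneg_of_vecMul_one_sub_nonneg (hB : ∀ i j, 0 ≤ B i j) (hsum : ∀ j, ∑ i, B i j < 1)
    {v : n → ℝ} (hv : 0 ≤ v ᵥ* (1 - B)) : 0 ≤ v := by
  intro i
  have : Nonempty n := ⟨i⟩
  obtain ⟨k, hk⟩ := Finite.exists_min v
  refine le_trans ?_ (hk i)
  have hvk : 0 ≤ v k - ∑ j, v j * B j k := by
    have h := hv k
    rwa [vecMul_sub, vecMul_one] at h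
  have hmin : v k * ∑ j, B j k ≤ ∑ j, v j * B j k := by
    rw [Finset.mul_sum]
    exact Finset.sum_le_sum fun j _ => mul_le_mul_of_nonneg_right (hk j) (hB j k)
  have hpos : 0 < 1 - ∑ j, B j k := sub_pos.2 (hsum k)
  exact nonneg_of_mul_nonneg_left (by linarith : 0 ≤ v k * (1 - ∑ j, B j k)) hpos

theorem isUnit_one_sub_of_sum_col_lt_one (hB : ∀ i j, 0 ≤ B i j)
    (hsum : ∀ j, ∑ i, B i j < 1) : IsUnit (1 - B) := by
  rw [← vecMul_injective_iff_isUnit]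
  intro v w hvw
  have hvw : v ᵥ* (1 - B) = w ᵥ* (1 - B) := hvw
  apply le_antisymm <;> rw [← sub_nonneg] <;>
    exact nonneg_of_vecMul_one_sub_nonneg hB hsum (by rw [sub_vecMul, hvw, sub_self])

theorem inv_one_sub_nonneg_of_sum_col_lt_one (hB : ∀ i j, 0 ≤ B i j)
    (hsum : ∀ j, ∑ i, B i j < 1) (i j : n) : 0 ≤ (1 - B)⁻¹ i j := by
  have hdet := (isUnit_iff_isUnit_det _).1 (isUnit_one_sub_of_sum_col_lt_one hB hsum)
  refine nonneg_of_vecMul_one_sub_nonneg hB hsum (v := (1 - B)⁻¹ i) (fun k => ?_) j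
  change 0 ≤ ((1 - B)⁻¹ * (1 - B)) i k
  rw [nonsing_inv_mul _ hdet, one_apply]
  split_ifs <;> norm_num

/-- Entrywise monotonicity of the Leontief inverse `(1 - B)⁻¹` in `B`. -/
theorem inv_one_sub_le_inv_one_sub {C : Matrix n n ℝ} (hB : ∀ i j, 0 ≤ B i j)
    (hBC : ∀ i j, B i j ≤ C i j) (hsum : ∀ j, ∑ i, C i j < 1) (i j : n) :
    (1 - B)⁻¹ i j ≤ (1 - C)⁻¹ i j := by
  have hC : ∀ i j, 0 ≤ C i j := fun i j => (hB i j).trans (hBC i j)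
  have hsumB : ∀ j, ∑ i, B i j < 1 := fun j =>
    (Finset.sum_le_sum fun i _ => hBC i j).trans_lt (hsum j)
  have hdetB := (isUnit_iff_isUnit_det _).1 (isUnit_one_sub_of_sum_col_lt_one hB hsumB)
  have hdetC := (isUnit_iff_isUnit_det _).1 (isUnit_one_sub_of_sum_col_lt_one hC hsum)
  have hdiff : (1 - C)⁻¹ - (1 - B)⁻¹ = (1 - C)⁻¹ * (C - B) * (1 - B)⁻¹ := by
    rw [show C - B = (1 - B) - (1 - C) by abel, mul_sub, sub_mul, nonsing_inv_mul _ hdetC,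
      one_mul, mul_nonsing_inv_cancel_right _ _ hdetB]
  rw [← sub_nonneg, ← sub_apply, hdiff, mul_apply]
  refine Finset.sum_nonneg fun k _ => mul_nonneg ?_
    (inv_one_sub_nonneg_of_sum_col_lt_one hB hsumB k j)
  rw [mul_apply]
  exact Finset.sum_nonneg fun l _ => mul_nonneg
    (inv_one_sub_nonneg_of_sum_col_lt_one hC hsum i l) (sub_nonneg.2 (hBC l k))

end Matrix

/-- Monotonicity of the dampened Input Rank (Appendix B): for dampening factors
`0 ≤ χ ≤ χ' ≤ 1`, both `I − χ·G·A` and `I − χ'·G·A` are invertible and every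
entry of `(I − χ·G·A)⁻¹` is at most the corresponding entry of `(I − χ'·G·A)⁻¹`;
in particular the dampened Input Rank never exceeds the full-information one. -/
theorem input_rank_dampening_monotone
    (M : ℕ) (G : Matrix (Fin M) (Fin M) ℝ)
    (hG_nonneg : ∀ h k, 0 ≤ G h k)
    (hG_col : ∀ k, ∑ h, G h k = 1)
    (α : Fin M → ℝ) (hα0 : ∀ k, 0 ≤ α k) (hα1 : ∀ k, α k < 1)
    (χ χ' : ℝ) (hχ0 : 0 ≤ χ) (hχχ' : χ ≤ χ') (hχ'1 : χ' ≤ 1) :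
    IsUnit (1 - χ • (G * Matrix.diagonal α)) ∧
    IsUnit (1 - χ' • (G * Matrix.diagonal α)) ∧
    ∀ h k, (1 - χ • (G * Matrix.diagonal α))⁻¹ h k ≤
           (1 - χ' • (G * Matrix.diagonal α))⁻¹ h k := by
  have hGA : ∀ h k, 0 ≤ (G * Matrix.diagonal α) h k := fun h k => by
    rw [mul_diagonal]
    exact mul_nonneg (hG_nonneg h k) (hα0 k)
  have hnonneg : ∀ c : ℝ, 0 ≤ c → ∀ h k, 0 ≤ (c • (G * Matrix.diagonal α)) h k :=
    fun c hc h k => mul_nonneg hc (hGA h k)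
  have hsum : ∀ c : ℝ, c ≤ 1 → ∀ k, ∑ h, (c • (G * Matrix.diagonal α)) h k < 1 := by
    intro c hc k
    simp only [Matrix.smul_apply, mul_diagonal, smul_eq_mul, ← Finset.mul_sum, ← Finset.sum_mul,
      hG_col, one_mul]
    exact (mul_le_of_le_one_left (hα0 k) hc).trans_lt (hα1 k)
  exact ⟨isUnit_one_sub_of_sum_col_lt_one (hnonneg χ hχ0) (hsum χ (hχχ'.trans hχ'1)),
    isUnit_one_sub_of_sum_col_lt_one (hnonneg χ' (hχ0.trans hχχ')) (hsum χ' hχ'1),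
    inv_one_sub_le_inv_one_sub (hnonneg χ hχ0)
      (fun h k => mul_le_mul_of_nonneg_right hχχ' (hGA h k)) (hsum χ' hχ'1)⟩
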